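/- arXiv:1204.0494 — 2 statements merged into one kernel-verified Lean document; each statement's English description precedes it below -/
import Mathlib

section
/- Let P_n be the path graph on n ≥ 2 vertices. For every finite simple graph G of minimum degree δ ≥ 1, γo(G □ P_n) ≥ ⌈(n−1)·γo(G)/2⌉ + ⌈δ/2⌉, where γo denotes the global offensive alliance number. -/
open SimpleGraph

/-- `S` is a global offensive alliance in `G`: every vertex outside `S` has at least
one more neighbor inside `S` than outside `S`. -/
def IsGlobalOffensiveAlliance {V : Type*} (G : SimpleGraph V) (S : Set V) : Prop :=
  ∀ v ∉ S, (G.neighborSet v ∩ S).ncard ≥ (G.neighborSet v \ S).ncard + 1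

/-- `S` is a global strong offensive alliance in `G`. -/
def IsGlobalStrongOffensiveAlliance {V : Type*} (G : SimpleGraph V) (S : Set V) : Prop :=
  ∀ v ∉ S, (G.neighborSet v ∩ S).ncard ≥ (G.neighborSet v \ S).ncard

/-- The global offensive alliance number `γₒ(G)`. -/
noncomputable def globalOffensiveAllianceNumber {V : Type*} (G : SimpleGraph V) : ℕ :=
  sInf {n | ∃ S : Set V, IsGlobalOffensiveAlliance G S ∧ S.ncard = n}

/-- `S` is a dominating set in `G`. -/
def IsDominatingSet {V : Type*} (G : SimpleGraph V) (S : Set V) : Prop :=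
  ∀ v ∉ S, ∃ u ∈ S, G.Adj u v

/-- The domination number `γ(G)`. -/
noncomputable def dominationNumber {V : Type*} (G : SimpleGraph V) : ℕ :=
  sInf {n | ∃ S : Set V, IsDominatingSet G S ∧ S.ncard = n}

/-- `S` is an efficient dominating set: a dominating set whose closed neighborhoods
are pairwise disjoint. -/
def IsEfficientDominatingSet {V : Type*} (G : SimpleGraph V) (S : Set V) : Prop :=
  IsDominatingSet G S ∧
    S.Pairwise fun u w =>
      Disjoint (insert u (G.neighborSet u)) (insert w (G.neighborSet w))

/-- The layer of `S` over the vertex `i` of the second factor. -/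
def boxLayer {V W : Type*} (S : Set (V × W)) (i : W) : Set V := {v | (v, i) ∈ S}

theorem ncard_neighborSet_boxProd_inter {V W : Type*} [Finite V] [Finite W]
    (G : SimpleGraph V) (H : SimpleGraph W) (T : Set (V × W)) (v : V) (i : W) :
    ((G.boxProd H).neighborSet (v, i) ∩ T).ncard =
      (G.neighborSet v ∩ boxLayer T i).ncard +
        (H.neighborSet i ∩ {j | (v, j) ∈ T}).ncard := by
  have hunion : (G.boxProd H).neighborSet (v, i) ∩ T =
      (fun w => (w, i)) '' (G.neighborSet v ∩ boxLayer T i) ∪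
        (fun j => (v, j)) '' (H.neighborSet i ∩ {j | (v, j) ∈ T}) := by
    ext ⟨w, j⟩
    simp only [boxLayer, Set.mem_inter_iff, mem_neighborSet, boxProd_adj, Set.mem_union,
      Set.mem_image, Set.mem_ofPred_eq, Prod.mk.injEq]
    constructor
    · rintro ⟨⟨h, rfl⟩ | ⟨h, rfl⟩, hT⟩
      · exact Or.inl ⟨w, ⟨h, hT⟩, rfl, rfl⟩
      · exact Or.inr ⟨j, ⟨h, hT⟩, rfl, rfl⟩
    · rintro (⟨w, ⟨h, hT⟩, rfl, rfl⟩ | ⟨j, ⟨h, hT⟩, rfl, rfl⟩)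
      · exact ⟨Or.inl ⟨h, rfl⟩, hT⟩
      · exact ⟨Or.inr ⟨h, rfl⟩, hT⟩
  have hdisj : Disjoint ((fun w => (w, i)) '' (G.neighborSet v ∩ boxLayer T i))
      ((fun j => (v, j)) '' (H.neighborSet i ∩ {j | (v, j) ∈ T})) := by
    rw [Set.disjoint_left]
    rintro _ ⟨w, ⟨hw, -⟩, rfl⟩ ⟨j, -, h⟩
    obtain rfl : v = w := congrArg Prod.fst h
    exact G.loopless.irrefl v hw
  rw [hunion, Set.ncard_union_eq hdisj (Set.toFinite _) (Set.toFinite _),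
    Set.ncard_image_of_injective _ (Prod.mk_left_injective i),
    Set.ncard_image_of_injective _ (Prod.mk_right_injective v)]

theorem IsGlobalOffensiveAlliance.boxProd_layer {V W : Type*} [Finite V] [Finite W]
    {G : SimpleGraph V} {H : SimpleGraph W} {S : Set (V × W)}
    (hS : IsGlobalOffensiveAlliance (G.boxProd H) S) {v : V} {i : W} (hv : v ∉ boxLayer S i) :
    (G.neighborSet v \ boxLayer S i).ncard + (H.neighborSet i \ {j | (v, j) ∈ S}).ncard + 1 ≤
      (G.neighborSet v ∩ boxLayer S i).ncard + (H.neighborSet i ∩ {j | (v, j) ∈ S}).ncard := by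
  have h := hS (v, i) hv
  rw [Set.sdiff_eq, ncard_neighborSet_boxProd_inter, ncard_neighborSet_boxProd_inter] at h
  exact h

theorem IsGlobalOffensiveAlliance.union_boxLayer {V W : Type*} [Finite V] [Finite W]
    {G : SimpleGraph V} {H : SimpleGraph W} {S : Set (V × W)}
    (hS : IsGlobalOffensiveAlliance (G.boxProd H) S) {i j : W} (hij : H.Adj i j)
    (hdeg : (H.neighborSet i).ncard ≤ 2) :
    IsGlobalOffensiveAlliance G (boxLayer S i ∪ boxLayer S j) := by
  intro v hv
  rw [Set.mem_union, not_or] at hv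
  have h := hS.boxProd_layer hv.1
  have hsum := Set.ncard_inter_add_ncard_sdiff_eq_ncard (H.neighborSet i) {k | (v, k) ∈ S}
    (Set.toFinite _)
  have hpos : 0 < (H.neighborSet i \ {k | (v, k) ∈ S}).ncard :=
    (Set.ncard_pos (Set.toFinite _)).2 ⟨j, hij, hv.2⟩
  have hin : (G.neighborSet v ∩ boxLayer S i).ncard ≤
      (G.neighborSet v ∩ (boxLayer S i ∪ boxLayer S j)).ncard :=
    Set.ncard_le_ncard (Set.inter_subset_inter_right _ Set.subset_union_left) (Set.toFinite _)
  have hout : (G.neighborSet v \ (boxLayer S i ∪ boxLayer S j)).ncard ≤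
      (G.neighborSet v \ boxLayer S i).ncard :=
    Set.ncard_le_ncard (Set.sdiff_subset_sdiff_right Set.subset_union_left) (Set.toFinite _)
  omega

theorem globalOffensiveAllianceNumber_le {V : Type*} {G : SimpleGraph V} {S : Set V}
    (hS : IsGlobalOffensiveAlliance G S) : globalOffensiveAllianceNumber G ≤ S.ncard :=
  Nat.sInf_le ⟨S, hS, rfl⟩

theorem exists_ncard_eq_globalOffensiveAllianceNumber {V : Type*} (G : SimpleGraph V) :
    ∃ S : Set V, IsGlobalOffensiveAlliance G S ∧ S.ncard = globalOffensiveAllianceNumber G :=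
  Nat.sInf_mem (s := {n | ∃ S : Set V, IsGlobalOffensiveAlliance G S ∧ S.ncard = n})
    ⟨_, Set.univ, fun v hv => absurd (Set.mem_univ v) hv, rfl⟩

theorem IsGlobalOffensiveAlliance.le_ncard_boxLayer_of_ncard_neighborSet_le_one
    {V W : Type*} [Fintype V] [Nonempty V] [Finite W]
    {G : SimpleGraph V} [DecidableRel G.Adj] {H : SimpleGraph W} {S : Set (V × W)}
    (hS : IsGlobalOffensiveAlliance (G.boxProd H) S) {i : W}
    (hdeg : (H.neighborSet i).ncard ≤ 1) : (G.minDegree + 1) / 2 ≤ (boxLayer S i).ncard := by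
  by_cases huniv : boxLayer S i = Set.univ
  · rw [huniv, Set.ncard_univ, Nat.card_eq_fintype_card]
    have h := G.minDegree_le_degree (Classical.arbitrary V)
    have h' := G.degree_lt_card_verts (Classical.arbitrary V)
    omega
  · obtain ⟨v, hv⟩ := (Set.ne_univ_iff_exists_notMem _).1 huniv
    have h := hS.boxProd_layer hv
    have hsum := Set.ncard_inter_add_ncard_sdiff_eq_ncard (H.neighborSet i) {k | (v, k) ∈ S}
      (Set.toFinite _)
    have hsumG := Set.ncard_inter_add_ncard_sdiff_eq_ncard (G.neighborSet v) (boxLayer S i)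
      (Set.toFinite _)
    have hle : (G.neighborSet v ∩ boxLayer S i).ncard ≤ (boxLayer S i).ncard :=
      Set.ncard_le_ncard Set.inter_subset_right (Set.toFinite _)
    have hmin := G.minDegree_le_degree v
    rw [← card_neighborSet_eq_degree, ← Nat.card_eq_fintype_card, Nat.card_coe_set_eq] at hmin
    omega

theorem ncard_eq_sum_ncard_boxLayer {V W : Type*} [Finite V] [Fintype W] (S : Set (V × W)) :
    S.ncard = ∑ i, (boxLayer S i).ncard := by
  let e : S ≃ Σ i, boxLayer S i :=
    { toFun := fun x => ⟨x.1.2, x.1.1, x.2⟩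
      invFun := fun y => ⟨(y.2.1, y.1), y.2.2⟩
      left_inv := fun _ => rfl
      right_inv := fun _ => rfl }
  rw [← Nat.card_coe_set_eq, Nat.card_congr e, Nat.card_sigma]
  rfl

theorem ncard_neighborSet_pathGraph_le_two {n : ℕ} (i : Fin n) :
    ((pathGraph n).neighborSet i).ncard ≤ 2 := by
  rw [← Set.ncard_image_of_injective _ Fin.val_injective]
  refine (Set.ncard_le_ncard (t := {i.val + 1, i.val - 1}) ?_ (Set.toFinite _)).trans
    ((Set.ncard_insert_le _ _).trans_eq (by rw [Set.ncard_singleton]))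
  rintro _ ⟨j, hj, rfl⟩
  simp only [mem_neighborSet, pathGraph_adj] at hj
  simp only [Set.mem_insert_iff, Set.mem_singleton_iff]
  omega

theorem ncard_neighborSet_pathGraph_le_one {n : ℕ} {i : Fin n}
    (hi : i.val = 0 ∨ i.val + 1 = n) : ((pathGraph n).neighborSet i).ncard ≤ 1 := by
  refine (Set.ncard_le_one (Set.toFinite _)).2 fun j hj k hk => ?_
  simp only [mem_neighborSet, pathGraph_adj] at hj hk
  omega

theorem mul_add_le_two_mul_sum_fin {g : ℕ} (m : ℕ) (f : Fin (m + 1) → ℕ)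
    (hf : ∀ i : Fin m, g ≤ f i.castSucc + f i.succ) :
    m * g + f 0 + f (Fin.last m) ≤ 2 * ∑ i, f i := by
  have h := Finset.sum_le_sum fun i (_ : i ∈ Finset.univ) => hf i
  rw [Finset.sum_add_distrib, Finset.sum_const, Finset.card_univ, Fintype.card_fin,
    smul_eq_mul] at h
  have h₁ := Fin.sum_univ_castSucc f
  have h₂ := Fin.sum_univ_succ f
  omega

theorem stmt4 {V : Type*} [Fintype V] [Nonempty V] (G : SimpleGraph V)
    [DecidableRel G.Adj] (hδ : 1 ≤ G.minDegree) (n : ℕ) (hn : 2 ≤ n) :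
    globalOffensiveAllianceNumber (G.boxProd (pathGraph n)) ≥
      ((n - 1) * globalOffensiveAllianceNumber G + 1) / 2 + (G.minDegree + 1) / 2 := by
  obtain ⟨m, rfl⟩ : ∃ m, n = m + 1 := ⟨n - 1, by omega⟩
  obtain ⟨S, hS, hcard⟩ :=
    exists_ncard_eq_globalOffensiveAllianceNumber (G.boxProd (pathGraph (m + 1)))
  have hsum := mul_add_le_two_mul_sum_fin (g := globalOffensiveAllianceNumber G) m
    (fun i => (boxLayer S i).ncard) fun i =>
      (globalOffensiveAllianceNumber_le (hS.union_boxLayer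
        (pathGraph_adj.2 (Or.inl (by simp)))
        (ncard_neighborSet_pathGraph_le_two i.castSucc))).trans (Set.ncard_union_le _ _)
  have hfirst := hS.le_ncard_boxLayer_of_ncard_neighborSet_le_one (i := 0)
    (ncard_neighborSet_pathGraph_le_one (Or.inl rfl))
  have hlast := hS.le_ncard_boxLayer_of_ncard_neighborSet_le_one (i := Fin.last m)
    (ncard_neighborSet_pathGraph_le_one (Or.inr rfl))
  rw [← ncard_eq_sum_ncard_boxLayer, hcard] at hsum
  rw [Nat.add_sub_cancel]
  omega
end

section
/- Let G be a finite simple graph whose vertex set can be partitioned into two global offensive alliances X_1 and X_2, and let H be a finite simple graph whose vertex set can be partitioned into two global strong offensive alliances Y_1 and Y_2. Then γo(G □ H) ≤ |X_1|·|Y_1| + |X_2|·|Y_2|, where γo denotes the global offensive alliance number. -/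
open SimpleGraph

/-- The neighbors of a vertex of `G □ H` lying in `T` are counted by the two slices of `T`
through that vertex. -/
theorem ncard_boxProd_neighborSet_inter {V W : Type*} [Finite V] [Finite W]
    (G : SimpleGraph V) (H : SimpleGraph W) (T : Set (V × W)) (a : V) (b : W) :
    ((G.boxProd H).neighborSet (a, b) ∩ T).ncard =
      (G.neighborSet a ∩ {x | (x, b) ∈ T}).ncard +
        (H.neighborSet b ∩ {y | (a, y) ∈ T}).ncard := by
  have hinl : Function.Injective fun x : V => (x, b) := fun _ _ h => congrArg Prod.fst h
  have hinr : Function.Injective fun y : W => (a, y) := fun _ _ h => congrArg Prod.snd h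
  rw [← Set.ncard_image_of_injective _ hinl, ← Set.ncard_image_of_injective _ hinr,
    ← Set.ncard_union_eq]
  · congr 1
    ext ⟨x, y⟩
    simp only [Set.mem_inter_iff, mem_neighborSet, boxProd_adj, Set.mem_union, Set.mem_image,
      Set.mem_ofPred_eq, Prod.mk.injEq]
    grind
  · rw [Set.disjoint_left]
    rintro _ ⟨x, ⟨hx, -⟩, rfl⟩ ⟨y, -, hy⟩
    obtain rfl : a = x := congrArg Prod.fst hy
    exact G.irrefl hx

/-- If, at every vertex outside `T`, the slices of `T` are a global offensive alliance in `G` and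
a global strong offensive alliance in `H` avoiding its coordinates, then `T` is a global offensive
alliance in `G □ H`. -/
theorem isGlobalOffensiveAlliance_boxProd {V W : Type*} [Finite V] [Finite W]
    (G : SimpleGraph V) (H : SimpleGraph W) (T : Set (V × W))
    (h : ∀ a b, (a, b) ∉ T →
      (∃ X, IsGlobalOffensiveAlliance G X ∧ a ∉ X ∧ {x | (x, b) ∈ T} = X) ∧
      ∃ Y, IsGlobalStrongOffensiveAlliance H Y ∧ b ∉ Y ∧ {y | (a, y) ∈ T} = Y) :
    IsGlobalOffensiveAlliance (G.boxProd H) T := by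
  rintro ⟨a, b⟩ hab
  obtain ⟨⟨X, hX, haX, rfl⟩, Y, hY, hbY, rfl⟩ := h a b hab
  have h₁ := hX a haX
  have h₂ := hY b hbY
  rw [Set.sdiff_eq] at h₁ h₂ ⊢
  rw [ncard_boxProd_neighborSet_inter, ncard_boxProd_neighborSet_inter]
  simp only [Set.mem_compl_iff, Set.compl_ofPred] at h₁ h₂ ⊢
  omega

theorem stmt12 {V W : Type*} [Fintype V] [Fintype W]
    (G : SimpleGraph V) (H : SimpleGraph W)
    (X₁ X₂ : Set V) (hXdisj : Disjoint X₁ X₂) (hXunion : X₁ ∪ X₂ = Set.univ)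
    (hX₁ : IsGlobalOffensiveAlliance G X₁) (hX₂ : IsGlobalOffensiveAlliance G X₂)
    (Y₁ Y₂ : Set W) (hYdisj : Disjoint Y₁ Y₂) (hYunion : Y₁ ∪ Y₂ = Set.univ)
    (hY₁ : IsGlobalStrongOffensiveAlliance H Y₁)
    (hY₂ : IsGlobalStrongOffensiveAlliance H Y₂) :
    globalOffensiveAllianceNumber (G.boxProd H) ≤
      X₁.ncard * Y₁.ncard + X₂.ncard * Y₂.ncard := by
  have hX (x : V) : x ∈ X₂ ↔ x ∉ X₁ :=
    ⟨fun h₂ h₁ => Set.disjoint_left.mp hXdisj h₁ h₂,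
      (hXunion.ge (Set.mem_univ x)).resolve_left⟩
  have hY (y : W) : y ∈ Y₂ ↔ y ∉ Y₁ :=
    ⟨fun h₂ h₁ => Set.disjoint_left.mp hYdisj h₁ h₂,
      (hYunion.ge (Set.mem_univ y)).resolve_left⟩
  have hS : IsGlobalOffensiveAlliance (G.boxProd H) (X₁ ×ˢ Y₁ ∪ X₂ ×ˢ Y₂) := by
    refine isGlobalOffensiveAlliance_boxProd G H _ fun a b hab => ?_
    simp only [Set.mem_union, Set.mem_prod, hX, hY] at hab ⊢
    by_cases ha : a ∈ X₁
    · have hb : b ∉ Y₁ := by tauto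
      exact ⟨⟨X₂, hX₂, by simp [hX, ha], by ext; simp [hX, hb]⟩,
        Y₁, hY₁, hb, by ext; simp [ha]⟩
    · have hb : b ∈ Y₁ := by tauto
      exact ⟨⟨X₁, hX₁, ha, by ext; simp [hb]⟩,
        Y₂, hY₂, by simp [hY, hb], by ext; simp [hY, ha]⟩
  calc globalOffensiveAllianceNumber (G.boxProd H)
      ≤ (X₁ ×ˢ Y₁ ∪ X₂ ×ˢ Y₂).ncard := Nat.sInf_le ⟨_, hS, rfl⟩
    _ ≤ (X₁ ×ˢ Y₁).ncard + (X₂ ×ˢ Y₂).ncard := Set.ncard_union_le _ _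
    _ = X₁.ncard * Y₁.ncard + X₂.ncard * Y₂.ncard := by rw [Set.ncard_prod, Set.ncard_prod]
end
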